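/- arXiv:1804.06328 — 2 statements merged into one kernel-verified Lean document; each statement's English description precedes it below -/
import Mathlib

section
/- Let S be a subset of a finite abelian group G. Then S is an even set in G if and only if for every y ∈ G with ν_S(y) > 0, the weight enumerator ν_S is constant on the orbit orb(y) = {y^i : i coprime to the order of y}; that is, ν_S(y^i) = ν_S(y) for all i coprime to ord(y). -/
open Finset

attribute [local instance] Classical.propDecidable

/-- The weight enumerator ν_A(y) = |{(a₁,a₂) ∈ A × A : y = a₁a₂⁻¹}|. -/
def nu {G : Type*} [CommGroup G] [DecidableEq G] (A : Finset G) (y : G) : ℕ :=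
  ((A ×ˢ A).filter (fun p => p.1 * p.2⁻¹ = y)).card

/-- S is an even set in G: SS^{(−1)} = Σ_{i=1}^r λ_i H_i for subgroups H_i and
nonzero integers λ_i, i.e. ν_S(y) = Σ_{i : y ∈ H_i} λ_i for every y. -/
def IsEvenSet {G : Type*} [CommGroup G] [DecidableEq G] (S : Finset G) : Prop :=
  ∃ (r : ℕ) (H : Fin r → Subgroup G) (lam : Fin r → ℤ),
    1 ≤ r ∧ (∀ i, lam i ≠ 0) ∧
    ∀ y : G, (nu S y : ℤ) = ∑ i, if y ∈ H i then lam i else 0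

lemma Subgroup.zpowers_pow_eq_zpowers_iff_coprime {G : Type*} [Group G] {y : G} {i : ℕ} :
    Subgroup.zpowers (y ^ i) = Subgroup.zpowers y ↔ Nat.Coprime i (orderOf y) := by
  rw [Nat.coprime_iff_gcd_eq_one, ← mem_zpowers_pow_iff]
  refine ⟨fun h => h ▸ Subgroup.mem_zpowers y, fun h => le_antisymm ?_ ?_⟩
  · exact Subgroup.zpowers_le.2 (Subgroup.npow_mem_zpowers y i)
  · exact Subgroup.zpowers_le.2 h

/-- The integer-valued indicator function of a subgroup. -/
noncomputable def Subgroup.intIndicator {G : Type*} [Group G] (H : Subgroup G) : G → ℤ :=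
  fun y => if y ∈ H then 1 else 0

/-- The indicator function of the set of generators of a subgroup. -/
noncomputable def Subgroup.generatorIndicator {G : Type*} [Group G] (H : Subgroup G) : G → ℤ :=
  fun y => if Subgroup.zpowers y = H then 1 else 0

lemma Subgroup.intIndicator_eq_sum_generatorIndicator {G : Type*} [Group G] [Fintype G]
    (H : Subgroup G) :
    H.intIndicator = ∑ K : Subgroup G with K ≤ H, K.generatorIndicator := by
  ext y
  simp [Subgroup.intIndicator, Subgroup.generatorIndicator, Finset.sum_apply]

lemma Subgroup.generatorIndicator_mem_span {G : Type*} [Group G] [Fintype G] (H : Subgroup G) :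
    H.generatorIndicator ∈
      Submodule.span ℤ (Set.range (Subgroup.intIndicator : Subgroup G → G → ℤ)) := by
  induction H using WellFoundedLT.induction with
  | ind H ih =>
    have hsplit : H.generatorIndicator =
        H.intIndicator - ∑ K : Subgroup G with K < H, K.generatorIndicator := by
      have hfilter : ({K : Subgroup G | K ≤ H} : Finset (Subgroup G)) =
          insert H ({K : Subgroup G | K < H} : Finset (Subgroup G)) := by
        ext K
        simp [le_iff_eq_or_lt]
      rw [H.intIndicator_eq_sum_generatorIndicator, hfilter, Finset.sum_insert (by simp)]
      abel
    rw [hsplit]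
    exact Submodule.sub_mem _ (Submodule.subset_span ⟨H, rfl⟩)
      (Submodule.sum_mem _ fun K hK => ih K (Finset.mem_filter.1 hK).2)

/-- A function that only depends on the cyclic subgroup generated by its argument is an integral
combination of indicator functions of subgroups. -/
lemma exists_sum_subgroup_of_zpowers_congr {G : Type*} [Group G] [Fintype G] (f : G → ℤ)
    (hf : ∀ y z, Subgroup.zpowers y = Subgroup.zpowers z → f y = f z) :
    ∃ c : Subgroup G → ℤ, ∀ y, f y = ∑ H, if y ∈ H then c H else 0 := by
  have hmem : f ∈
      Submodule.span ℤ (Set.range (Subgroup.intIndicator : Subgroup G → G → ℤ)) := by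
    obtain ⟨F, hF⟩ : ∃ F : Subgroup G → ℤ, ∀ y, f y = F (Subgroup.zpowers y) :=
      ⟨Function.extend Subgroup.zpowers f 0, fun y =>
        (Function.FactorsThrough.extend_apply (f := Subgroup.zpowers) (g := f)
          (fun {y z} => hf y z) 0 y).symm⟩
    have hsum : f = ∑ H : Subgroup G, F H • H.generatorIndicator := by
      ext y
      simp [Subgroup.generatorIndicator, Finset.sum_apply, hF]
    rw [hsum]
    exact Submodule.sum_mem _ fun H _ => Submodule.smul_mem _ _ H.generatorIndicator_mem_span
  obtain ⟨c, hc⟩ := (Submodule.mem_span_range_iff_exists_fun ℤ).1 hmem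
  refine ⟨c, fun y => ?_⟩
  rw [← hc]
  simp [Subgroup.intIndicator, Finset.sum_apply]

/-- Zero coefficients can be dropped; two cancelling terms ensure that the sum is not empty. -/
lemma isEvenSet_of_sum_subgroup {G : Type*} [CommGroup G] [Fintype G] [DecidableEq G]
    (S : Finset G) (c : Subgroup G → ℤ)
    (hc : ∀ y, (nu S y : ℤ) = ∑ H, if y ∈ H then c H else 0) : IsEvenSet S := by
  let ι := {H : Subgroup G // c H ≠ 0} ⊕ Bool
  let e : ι ≃ Fin (Fintype.card ι) := Fintype.equivFin ι
  let H : ι → Subgroup G := Sum.elim Subtype.val fun _ => ⊤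
  let lam : ι → ℤ := Sum.elim (fun K => c K) fun b => if b then 1 else -1
  refine ⟨Fintype.card ι, H ∘ e.symm, lam ∘ e.symm, ?_, fun i => ?_, fun y => ?_⟩
  · exact Fintype.card_pos_iff.2 ⟨Sum.inr true⟩
  · rcases h : e.symm i with K | b
    · simpa [lam, h] using K.2
    · cases b <;> simp [lam, h]
  · have hsum : ∑ i, (if y ∈ (H ∘ e.symm) i then (lam ∘ e.symm) i else 0) =
        ∑ i, if y ∈ H i then lam i else 0 :=
      e.symm.sum_comp fun i => if y ∈ H i then lam i else 0
    rw [hsum, hc, Fintype.sum_sum_type]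
    simp only [H, lam, Sum.elim_inl, Sum.elim_inr, Subgroup.mem_top, Fintype.sum_bool, if_true,
      Bool.false_eq_true, if_false, add_neg_cancel, add_zero]
    have hfilter : ∑ K : Subgroup G with c K ≠ 0, (if y ∈ K then c K else 0) =
        ∑ K : Subgroup G, if y ∈ K then c K else 0 :=
      Finset.sum_filter_of_ne fun K _ hK hcK => hK (by simp [hcK])
    rw [← hfilter]
    exact Finset.sum_subtype _ (by simp) _

/-- S is an even set in G if and only if for every y with ν_S(y) > 0,
the weight enumerator ν_S is constant on the orbit orb(y) = {y^i : gcd(i, ord(y)) = 1}. -/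
theorem isEvenSet_iff_nu_constant_on_orbits
    {G : Type*} [CommGroup G] [Fintype G] [DecidableEq G] (S : Finset G) :
    IsEvenSet S ↔
    ∀ y : G, 0 < nu S y → ∀ i : ℕ, Nat.Coprime i (orderOf y) →
      nu S (y ^ i) = nu S y := by
  constructor
  · rintro ⟨r, H, lam, -, -, hnu⟩ y - i hi
    have hmem (K : Subgroup G) : y ^ i ∈ K ↔ y ∈ K := by
      rw [← Subgroup.zpowers_le, Subgroup.zpowers_pow_eq_zpowers_iff_coprime.2 hi,
        Subgroup.zpowers_le]
    have hcast : (nu S (y ^ i) : ℤ) = nu S y := by simp only [hnu, hmem]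
    exact_mod_cast hcast
  · intro h
    have hpos (y z : G) (hy : 0 < nu S y) (hyz : Subgroup.zpowers y = Subgroup.zpowers z) :
        nu S z = nu S y := by
      obtain ⟨i, rfl⟩ : z ∈ Submonoid.powers y :=
        mem_powers_iff_mem_zpowers.2 (hyz ▸ Subgroup.mem_zpowers z)
      exact h y hy i (Subgroup.zpowers_pow_eq_zpowers_iff_coprime.1 hyz.symm)
    obtain ⟨c, hc⟩ := exists_sum_subgroup_of_zpowers_congr (fun y => (nu S y : ℤ)) (by
      intro y z hyz
      have := hpos y z
      have := hpos z y
      grind)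
    exact isEvenSet_of_sum_subgroup S c hc
end

section
/- Let p and q be primes and let e ≥ 1 be such that q is a primitive root modulo p^e (i.e., q generates the unit group (ℤ/p^eℤ)ˣ). Let ζ be a primitive p^e-th root of unity and let X ∈ ℤ[ζ] be nonzero, and suppose that |X|² = X·X̄ is a rational integer n. If q^f exactly divides n (q^f | n and q^{f+1} ∤ n), then f is even. In particular, if q^f | n with f odd, then q^{f+1} | n. -/
open Polynomial in
/-- If `q` generates `(ℤ/mℤ)ˣ`, then the `m`-th cyclotomic polynomial is irreducible over `𝔽_q`. -/
theorem irreducible_cyclotomic_zmod_of_generates {m q : ℕ} [NeZero m] [Fact q.Prime]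
    (hqm : ¬ q ∣ m)
    (hgen : ∀ a : ZMod m, IsUnit a → ∃ k : ℕ, a = (q : ZMod m) ^ k) :
    Irreducible (cyclotomic m (ZMod q)) := by
  have hq : q.Prime := Fact.out
  refine ZMod.irreducible_of_dvd_cyclotomic_of_natDegree hqm dvd_rfl ?_
  rw [natDegree_cyclotomic, ← ZMod.card_units_eq_totient, ← Nat.card_eq_fintype_card]
  refine (orderOf_eq_card_of_forall_mem_zpowers fun u => ?_).symm
  obtain ⟨k, hk⟩ := hgen u u.isUnit
  refine ⟨k, Units.ext ?_⟩
  simpa using hk.symm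

open Polynomial in
/-- An integer `q` divides `P(ζ)` in `ℤ[ζ]` iff the cyclotomic polynomial divides `P` mod `q`. -/
theorem natCast_dvd_aeval_iff_cyclotomic_dvd {m : ℕ} (hm : 0 < m) (q : ℕ) {ζ : ℂ}
    (hζ : IsPrimitiveRoot ζ m) (P : ℤ[X]) :
    (∃ Q : ℤ[X], aeval ζ P = (q : ℂ) * aeval ζ Q) ↔
      cyclotomic m (ZMod q) ∣ P.map (Int.castRingHom (ZMod q)) := by
  constructor
  · rintro ⟨Q, hQ⟩
    have h0 : aeval ζ (P - C (q : ℤ) * Q) = 0 := by simp [hQ]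
    have hdvd := minpoly.isIntegrallyClosed_dvd (hζ.isIntegral hm) h0
    rw [← cyclotomic_eq_minpoly hζ hm] at hdvd
    simpa using Polynomial.map_dvd (Int.castRingHom (ZMod q)) hdvd
  · rintro ⟨S, hS⟩
    obtain ⟨S, rfl⟩ := map_surjective _ (ZMod.ringHom_surjective (Int.castRingHom (ZMod q))) S
    have h0 : C (q : ℤ) ∣ P - cyclotomic m ℤ * S := by
      rw [C_dvd_iff_dvd_coeff]
      intro i
      rw [← ZMod.intCast_zmod_eq_zero_iff_dvd]
      have h : (P - cyclotomic m ℤ * S).map (Int.castRingHom (ZMod q)) = 0 := by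
        simp [hS]
      simpa only [coeff_map, coeff_zero, eq_intCast] using congrArg (fun T => T.coeff i) h
    obtain ⟨Q, hQ⟩ := h0
    refine ⟨Q, ?_⟩
    have hΦ : aeval ζ (cyclotomic m ℤ) = 0 := by
      rw [cyclotomic_eq_minpoly hζ hm]
      exact minpoly.aeval _ _
    simpa [hΦ] using congrArg (aeval ζ) hQ

open Polynomial in
/-- If the `m`-th cyclotomic polynomial is irreducible over `𝔽_q`, then `q` is prime in `ℤ[ζ]`. -/
theorem prime_natCast_adjoin_of_irreducible_cyclotomic {m q : ℕ} (hm : 0 < m) [Fact q.Prime]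
    {ζ : ℂ} (hζ : IsPrimitiveRoot ζ m) (hirr : Irreducible (cyclotomic m (ZMod q))) :
    Prime (q : Algebra.adjoin ℤ ({ζ} : Set ℂ)) := by
  have hq : q.Prime := Fact.out
  have hrep (x : Algebra.adjoin ℤ ({ζ} : Set ℂ)) : ∃ P : ℤ[X], aeval ζ P = (x : ℂ) :=
    (AlgHom.mem_range _).1 ((Algebra.adjoin_singleton_eq_range_aeval ℤ ζ).le x.2)
  have key (x : Algebra.adjoin ℤ ({ζ} : Set ℂ)) (P : ℤ[X]) (hP : aeval ζ P = (x : ℂ)) :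
      (q : Algebra.adjoin ℤ ({ζ} : Set ℂ)) ∣ x ↔
        cyclotomic m (ZMod q) ∣ P.map (Int.castRingHom (ZMod q)) := by
    rw [← natCast_dvd_aeval_iff_cyclotomic_dvd hm q hζ P, hP]
    constructor
    · rintro ⟨y, rfl⟩
      obtain ⟨Q, hQ⟩ := hrep y
      exact ⟨Q, by simp [hQ]⟩
    · rintro ⟨Q, hQ⟩
      exact ⟨⟨aeval ζ Q, aeval_mem_adjoin_singleton ℤ ζ⟩, Subtype.ext (by simp [hQ])⟩
  refine ⟨by exact_mod_cast hq.ne_zero, fun hu => ?_, fun x y hxy => ?_⟩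
  · have h := (key 1 1 (by simp)).1 hu.dvd
    rw [Polynomial.map_one] at h
    exact hirr.not_isUnit (isUnit_of_dvd_one h)
  · obtain ⟨P, hP⟩ := hrep x
    obtain ⟨Q, hQ⟩ := hrep y
    rw [key (x * y) (P * Q) (by simp [hP, hQ]), Polynomial.map_mul] at hxy
    rw [key x P hP, key y Q hQ]
    exact hirr.prime.dvd_or_dvd hxy

/-- Divisibility between integers can be tested in any ring of algebraic integers in `ℂ`. -/
theorem intCast_dvd_intCast_subalgebra_iff (S : Subalgebra ℤ ℂ) (hS : ∀ x ∈ S, IsIntegral ℤ x)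
    (a b : ℤ) : (a : S) ∣ (b : S) ↔ a ∣ b := by
  refine ⟨?_, fun h => by exact_mod_cast map_dvd (Int.castRingHom S) h⟩
  rintro ⟨y, hy⟩
  have hyC : (b : ℂ) = a * (y : ℂ) := by simpa using congrArg (fun z : S => (z : ℂ)) hy
  rcases eq_or_ne a 0 with rfl | ha
  · have : b = 0 := by simpa using hyC
    simp [this]
  have hyq : (y : ℂ) = algebraMap ℚ ℂ (b / a) := by
    have : (a : ℂ) ≠ 0 := by exact_mod_cast ha
    rw [eq_ratCast]
    push_cast
    field_simp
    rw [hyC]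
    ring
  have hint := hS y y.2
  rw [hyq, isIntegral_algebraMap_iff (algebraMap ℚ ℂ).injective,
    IsIntegrallyClosed.isIntegral_iff] at hint
  obtain ⟨c, hc⟩ := hint
  refine ⟨c, ?_⟩
  have ha' : (a : ℚ) ≠ 0 := by exact_mod_cast ha
  rw [eq_div_iff ha'] at hc
  rw [eq_intCast] at hc
  have : c * a = b := by exact_mod_cast hc
  rw [← this, mul_comm]

/-- `ℤ[ζ]` is stable under complex conjugation for a root of unity `ζ`. -/
theorem conj_mem_adjoin_of_pow_eq_one {m : ℕ} (hm : m ≠ 0) {ζ : ℂ} (hζ : ζ ^ m = 1) {x : ℂ}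
    (hx : x ∈ Algebra.adjoin ℤ ({ζ} : Set ℂ)) :
    (starRingEnd ℂ) x ∈ Algebra.adjoin ℤ ({ζ} : Set ℂ) := by
  have hζmem : (starRingEnd ℂ) ζ ∈ Algebra.adjoin ℤ ({ζ} : Set ℂ) := by
    have h : (starRingEnd ℂ) ζ = ζ ^ (m - 1) := by
      rw [← Complex.inv_eq_conj (Complex.norm_eq_one_of_pow_eq_one hζ hm)]
      refine inv_eq_of_mul_eq_one_right ?_
      rw [← pow_succ', Nat.sub_one_add_one hm, hζ]
    rw [h]
    exact pow_mem (Algebra.self_mem_adjoin_singleton ℤ ζ) _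
  induction hx using Algebra.adjoin_induction with
  | mem x hx => rwa [Set.mem_singleton_iff.1 hx]
  | algebraMap r => simp
  | add x y _ _ hx hy => simpa using add_mem hx hy
  | mul x y _ _ hx hy => simpa using mul_mem hx hy

/-- If the rational prime `q` stays prime in a conjugation-stable ring `S` of algebraic integers,
then it divides every rational integer of the form `x * conj x` to an even power. -/
theorem even_of_exact_power_dvd_mul_conj (S : Subalgebra ℤ ℂ) (hS : ∀ x ∈ S, IsIntegral ℤ x)
    (hconj : ∀ x ∈ S, (starRingEnd ℂ) x ∈ S) {q : ℕ} (hq : Prime (q : S)) {x : ℂ} (hx : x ∈ S)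
    {n : ℤ} (hn : x * (starRingEnd ℂ) x = (n : ℂ)) {f : ℕ} (hf : (q : ℤ) ^ f ∣ n)
    (hf' : ¬ (q : ℤ) ^ (f + 1) ∣ n) : Even f := by
  have hstep (y : S) (k : ℕ) (h : (q : S) ^ k ∣ y) :
      (q : S) ^ k ∣ ⟨(starRingEnd ℂ) y, hconj y y.2⟩ := by
    obtain ⟨z, rfl⟩ := h
    exact ⟨⟨(starRingEnd ℂ) z, hconj z z.2⟩, Subtype.ext (by simp)⟩
  let y : S := ⟨x, hx⟩
  let y' : S := ⟨(starRingEnd ℂ) x, hconj x hx⟩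
  have hyy' : emultiplicity (q : S) y' = emultiplicity (q : S) y := by
    refine emultiplicity_eq_emultiplicity_iff.2 fun {k} => ⟨fun h => ?_, hstep y k⟩
    simpa [y, y'] using hstep y' k h
  have hmul : y * y' = (n : S) := Subtype.ext (by simpa [y, y'] using hn)
  have hnf : emultiplicity (q : S) (n : S) = f := by
    rw [emultiplicity_eq_coe]
    have h (k : ℕ) : (q : S) ^ k ∣ (n : S) ↔ (q : ℤ) ^ k ∣ n := by
      rw [← intCast_dvd_intCast_subalgebra_iff S hS]
      simp
    exact ⟨(h f).2 hf, fun h' => hf' ((h _).1 h')⟩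
  rw [← hmul, emultiplicity_mul hq, hyy'] at hnf
  have hfin : emultiplicity (q : S) y ≠ ⊤ := by
    intro h
    simp [h] at hnf
  lift emultiplicity (q : S) y to ℕ using hfin with k
  exact ⟨k, by exact_mod_cast hnf.symm⟩

/-- A prime `p` generating `(ℤ/p^eℤ)ˣ` forces `p ^ e = 2`. -/
theorem prime_pow_eq_two_of_self_generates {p e : ℕ} (hp : p.Prime) (he : 1 ≤ e)
    (hgen : ∀ a : ZMod (p ^ e), IsUnit a → ∃ k : ℕ, a = (p : ZMod (p ^ e)) ^ k) :
    p ^ e = 2 := by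
  have h1 : 1 < p ^ e := Nat.one_lt_pow (by omega) hp.one_lt
  have : Fact (1 < p ^ e) := ⟨h1⟩
  obtain ⟨k, hk⟩ := hgen (-1) isUnit_one.neg
  have hk0 : k = 0 := by
    by_contra hk0
    have hu : IsUnit ((p : ZMod (p ^ e)) ^ k) := hk ▸ isUnit_one.neg
    rw [isUnit_pow_iff hk0, ZMod.isUnit_iff_coprime, Nat.coprime_pow_right_iff (by omega),
      Nat.coprime_self] at hu
    exact hp.one_lt.ne' hu
  rw [hk0, pow_zero] at hk
  have h2 : ((2 : ℕ) : ZMod (p ^ e)) = 0 := by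
    push_cast
    linear_combination -hk
  rw [ZMod.natCast_eq_zero_iff] at h2
  exact le_antisymm (Nat.le_of_dvd two_pos h2) h1

/-- Let p, q be primes and e ≥ 1 with q a primitive root modulo p^e.
Let ζ be a primitive p^e-th root of unity in ℂ and X ∈ ℤ[ζ] nonzero with
|X|² = X·X̄ equal to a rational integer n. If q^f exactly divides n, then f is even;
in particular if q^f ∣ n with f odd, then q^{f+1} ∣ n. -/
theorem cyclotomic_exact_power_even
    (p q : ℕ) (hp : p.Prime) (hq : q.Prime) (e : ℕ) (he : 1 ≤ e)
    (hprim : ∀ a : ZMod (p ^ e), IsUnit a → ∃ k : ℕ, a = (q : ZMod (p ^ e)) ^ k)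
    (ζ : ℂ) (hζ : IsPrimitiveRoot ζ (p ^ e))
    (X : ℂ) (hX : X ≠ 0) (hXmem : X ∈ Algebra.adjoin ℤ ({ζ} : Set ℂ))
    (n : ℤ) (hn : X * (starRingEnd ℂ) X = (n : ℂ)) :
    (∀ f : ℕ, (q : ℤ) ^ f ∣ n → ¬ (q : ℤ) ^ (f + 1) ∣ n → Even f) ∧
    (∀ f : ℕ, (q : ℤ) ^ f ∣ n → Odd f → (q : ℤ) ^ (f + 1) ∣ n) := by
  have hm : 0 < p ^ e := pow_pos hp.pos e
  have : NeZero (p ^ e) := ⟨hm.ne'⟩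
  have : Fact q.Prime := ⟨hq⟩
  have hirr : Irreducible (Polynomial.cyclotomic (p ^ e) (ZMod q)) := by
    by_cases hqp : q ∣ p ^ e
    · obtain rfl := (Nat.prime_dvd_prime_iff_eq hq hp).1 (hq.dvd_of_dvd_pow hqp)
      rw [prime_pow_eq_two_of_self_generates hp he hprim, Polynomial.cyclotomic_two]
      simpa using Polynomial.irreducible_X_sub_C (-1 : ZMod q)
    · exact irreducible_cyclotomic_zmod_of_generates hqp hprim
  have heven : ∀ f : ℕ, (q : ℤ) ^ f ∣ n → ¬ (q : ℤ) ^ (f + 1) ∣ n → Even f := fun f =>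
    even_of_exact_power_dvd_mul_conj (Algebra.adjoin ℤ {ζ})
      (fun _ hx => ((Algebra.IsIntegral.adjoin (by simpa using hζ.isIntegral hm)).isIntegral
        ⟨_, hx⟩).map (Algebra.adjoin ℤ {ζ}).val)
      (fun _ => conj_mem_adjoin_of_pow_eq_one hm.ne' hζ.pow_eq_one)
      (prime_natCast_adjoin_of_irreducible_cyclotomic hm hζ hirr) hXmem hn
  exact ⟨heven, fun f hf hodd => by_contra fun h => Nat.not_even_iff_odd.2 hodd (heven f hf h)⟩
end
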